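/- arXiv:1812.07387 — 2 statements merged into one kernel-verified Lean document; each statement's English description precedes it below -/
import Mathlib

section
/- Let u, v : ℝ² → ℂ be twice continuously differentiable functions of (x,t). Then the zero-curvature equation ∂U/∂t − ∂V/∂x + UV − VU = 0 holds identically on ℝ² for every λ ∈ ℂ if and only if (u,v) solves the CDNLS system i u_t + u_xx + i(ρu)_x = 0, i v_t + v_xx + i(ρv)_x = 0. -/
open Matrix Complex ComplexConjugate

noncomputable section

abbrev M3 := Matrix (Fin 3) (Fin 3) ℂ

/-- `Λ = diag(-1,1,1)` -/
def Lam : M3 := !![(-1 : ℂ), 0, 0; 0, 1, 0; 0, 0, 1]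

/-- `A = diag(1,-1,-1)` -/
def Amat : M3 := !![(1 : ℂ), 0, 0; 0, -1, 0; 0, 0, -1]

/-- partial derivative in the first (space) variable -/
def pdx (f : ℝ × ℝ → ℂ) (p : ℝ × ℝ) : ℂ := deriv (fun x => f (x, p.2)) p.1

/-- partial derivative in the second (time) variable -/
def pdt (f : ℝ × ℝ → ℂ) (p : ℝ × ℝ) : ℂ := deriv (fun t => f (p.1, t)) p.2

/-- entrywise partial x-derivative of a matrix-valued function -/
def pdxM (F : ℝ × ℝ → M3) (p : ℝ × ℝ) : M3 :=
  Matrix.of fun i j => deriv (fun x => F (x, p.2) i j) p.1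

/-- entrywise partial t-derivative of a matrix-valued function -/
def pdtM (F : ℝ × ℝ → M3) (p : ℝ × ℝ) : M3 :=
  Matrix.of fun i j => deriv (fun t => F (p.1, t) i j) p.2

/-- `ρ = |u|² + |v|²` -/
def rho (u v : ℝ × ℝ → ℂ) (p : ℝ × ℝ) : ℂ := conj (u p) * u p + conj (v p) * v p

def U1mat (u v : ℝ × ℝ → ℂ) (p : ℝ × ℝ) : M3 :=
  !![0, u p, v p; conj (u p), 0, 0; conj (v p), 0, 0]

def U2mat (u v : ℝ × ℝ → ℂ) (p : ℝ × ℝ) : M3 :=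
  !![-(rho u v p), 0, 0;
     0, conj (u p) * u p, conj (u p) * v p;
     0, u p * conj (v p), conj (v p) * v p]

def U3mat (u v : ℝ × ℝ → ℂ) (p : ℝ × ℝ) : M3 :=
  !![0, u p * rho u v p - I * pdx u p, v p * rho u v p - I * pdx v p;
     conj (u p) * rho u v p + I * pdx (fun q => conj (u q)) p, 0, 0;
     conj (v p) * rho u v p + I * pdx (fun q => conj (v q)) p, 0, 0]

/-- `U(x,t,λ) = -iλ²Λ + λU₁` -/
def Umat (u v : ℝ × ℝ → ℂ) (lam : ℂ) (p : ℝ × ℝ) : M3 :=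
  (-(I * lam ^ 2)) • Lam + lam • U1mat u v p

/-- `V(x,t,λ) = 2iλ⁴Λ - 2λ³U₁ + iλ²U₂ - λU₃` -/
def Vmat (u v : ℝ × ℝ → ℂ) (lam : ℂ) (p : ℝ × ℝ) : M3 :=
  (2 * I * lam ^ 4) • Lam - (2 * lam ^ 3) • U1mat u v p + (I * lam ^ 2) • U2mat u v p
    - lam • U3mat u v p

/-- `V₁ = λU₁` -/
def V1mat (u v : ℝ × ℝ → ℂ) (lam : ℂ) (p : ℝ × ℝ) : M3 := lam • U1mat u v p

/-- `V₂ = -2λ³U₁ + iλ²U₂ - λU₃` -/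
def V2mat (u v : ℝ × ℝ → ℂ) (lam : ℂ) (p : ℝ × ℝ) : M3 :=
  (-(2 * lam ^ 3)) • U1mat u v p + (I * lam ^ 2) • U2mat u v p - lam • U3mat u v p

/-- The `x`-slices of a `C²` function are differentiable, with derivative `pdx`. -/
theorem hasDerivAt_pdx {f : ℝ × ℝ → ℂ} (hf : ContDiff ℝ 2 f) (p : ℝ × ℝ) :
    HasDerivAt (fun x => f (x, p.2)) (pdx f p) p.1 := by
  have h : ContDiff ℝ 2 (fun x : ℝ => f (x, p.2)) := by fun_prop
  exact (h.differentiable (by norm_num) p.1).hasDerivAt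

theorem hasDerivAt_pdt {f : ℝ × ℝ → ℂ} (hf : ContDiff ℝ 2 f) (p : ℝ × ℝ) :
    HasDerivAt (fun t => f (p.1, t)) (pdt f p) p.2 := by
  have h : ContDiff ℝ 2 (fun t : ℝ => f (p.1, t)) := by fun_prop
  exact (h.differentiable (by norm_num) p.2).hasDerivAt

theorem hasDerivAt_pdx_pdx {f : ℝ × ℝ → ℂ} (hf : ContDiff ℝ 2 f) (p : ℝ × ℝ) :
    HasDerivAt (fun x => pdx f (x, p.2)) (pdx (pdx f) p) p.1 := by
  have h : ContDiff ℝ 2 (fun x : ℝ => f (x, p.2)) := by fun_prop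
  exact (h.differentiable_deriv_two p.1).hasDerivAt

theorem HasDerivAt.conj_comp {g : ℝ → ℂ} {g' : ℂ} {x : ℝ} (h : HasDerivAt g g' x) :
    HasDerivAt (fun y => conj (g y)) (conj g') x :=
  h.star

theorem pdx_conj (f : ℝ × ℝ → ℂ) (p : ℝ × ℝ) :
    pdx (fun q => conj (f q)) p = conj (pdx f p) :=
  deriv.star (f := fun x => f (x, p.2)) (x := p.1)

theorem hasDerivAt_rho_mul {u v f : ℝ × ℝ → ℂ} (hu : ContDiff ℝ 2 u) (hv : ContDiff ℝ 2 v)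
    (hf : ContDiff ℝ 2 f) (p : ℝ × ℝ) :
    HasDerivAt (fun x => rho u v (x, p.2) * f (x, p.2))
      (pdx (fun q => rho u v q * f q) p) p.1 :=
  (((((hasDerivAt_pdx hu p).conj_comp.mul (hasDerivAt_pdx hu p)).add
    ((hasDerivAt_pdx hv p).conj_comp.mul (hasDerivAt_pdx hv p))).mul
      (hasDerivAt_pdx hf p)).differentiableAt).hasDerivAt

theorem conj_rho (u v : ℝ × ℝ → ℂ) (p : ℝ × ℝ) : conj (rho u v p) = rho u v p := by
  simp [rho, mul_comm]

theorem pdtM_Umat {u v : ℝ × ℝ → ℂ} (hu : ContDiff ℝ 2 u) (hv : ContDiff ℝ 2 v) (lam : ℂ)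
    (p : ℝ × ℝ) :
    pdtM (Umat u v lam) p =
      lam • !![0, pdt u p, pdt v p; conj (pdt u p), 0, 0; conj (pdt v p), 0, 0] := by
  have hu' := hasDerivAt_pdt hu p
  have hv' := hasDerivAt_pdt hv p
  ext i j
  fin_cases i <;> fin_cases j <;> simp [pdtM, Umat, Lam, U1mat]
  · exact Or.inl hu'.deriv
  · exact Or.inl hv'.deriv
  · exact Or.inl hu'.conj_comp.deriv
  · exact Or.inl hv'.conj_comp.deriv

theorem pdxM_Vmat {u v : ℝ × ℝ → ℂ} (hu : ContDiff ℝ 2 u) (hv : ContDiff ℝ 2 v) (lam : ℂ)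
    (p : ℝ × ℝ) :
    pdxM (Vmat u v lam) p =
      -(2 * lam ^ 3) • !![0, pdx u p, pdx v p; conj (pdx u p), 0, 0; conj (pdx v p), 0, 0]
      + (I * lam ^ 2) •
        !![-(conj (pdx u p) * u p + conj (u p) * pdx u p
              + (conj (pdx v p) * v p + conj (v p) * pdx v p)), 0, 0;
           0, conj (pdx u p) * u p + conj (u p) * pdx u p,
              conj (pdx u p) * v p + conj (u p) * pdx v p;
           0, pdx u p * conj (v p) + u p * conj (pdx v p),
              conj (pdx v p) * v p + conj (v p) * pdx v p]
      - lam •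
        !![0, pdx (fun q => rho u v q * u q) p - I * pdx (pdx u) p,
              pdx (fun q => rho u v q * v q) p - I * pdx (pdx v) p;
           conj (pdx (fun q => rho u v q * u q) p - I * pdx (pdx u) p), 0, 0;
           conj (pdx (fun q => rho u v q * v q) p - I * pdx (pdx v) p), 0, 0] := by
  have hu₁ := hasDerivAt_pdx hu p
  have hv₁ := hasDerivAt_pdx hv p
  have hu₃ := (hasDerivAt_rho_mul hu hv hu p).sub ((hasDerivAt_pdx_pdx hu p).const_mul I)
  have hv₃ := (hasDerivAt_rho_mul hu hv hv p).sub ((hasDerivAt_pdx_pdx hv p).const_mul I)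
  have huu := hu₁.conj_comp.mul hu₁
  have hvv := hv₁.conj_comp.mul hv₁
  have hU₁ : ∀ i j, HasDerivAt (fun x => U1mat u v (x, p.2) i j)
      (!![0, pdx u p, pdx v p; conj (pdx u p), 0, 0; conj (pdx v p), 0, 0] i j) p.1 := by
    intro i j
    fin_cases i <;> fin_cases j <;>
      first
        | exact hasDerivAt_const _ _
        | exact hu₁
        | exact hv₁
        | exact hu₁.conj_comp
        | exact hv₁.conj_comp
  have hU₂ : ∀ i j, HasDerivAt (fun x => U2mat u v (x, p.2) i j)
      (!![-(conj (pdx u p) * u p + conj (u p) * pdx u p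
              + (conj (pdx v p) * v p + conj (v p) * pdx v p)), 0, 0;
           0, conj (pdx u p) * u p + conj (u p) * pdx u p,
              conj (pdx u p) * v p + conj (u p) * pdx v p;
           0, pdx u p * conj (v p) + u p * conj (pdx v p),
              conj (pdx v p) * v p + conj (v p) * pdx v p] i j) p.1 := by
    intro i j
    fin_cases i <;> fin_cases j <;>
      first
        | exact hasDerivAt_const _ _
        | exact (huu.add hvv).neg
        | exact huu
        | exact hvv
        | exact hu₁.conj_comp.mul hv₁
        | exact hu₁.mul hv₁.conj_comp
  have hU₃ : ∀ i j, HasDerivAt (fun x => U3mat u v (x, p.2) i j)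
      (!![0, pdx (fun q => rho u v q * u q) p - I * pdx (pdx u) p,
              pdx (fun q => rho u v q * v q) p - I * pdx (pdx v) p;
           conj (pdx (fun q => rho u v q * u q) p - I * pdx (pdx u) p), 0, 0;
           conj (pdx (fun q => rho u v q * v q) p - I * pdx (pdx v) p), 0, 0] i j) p.1 := by
    intro i j
    fin_cases i <;> fin_cases j <;>
      simp only [U3mat, pdx_conj, Fin.zero_eta, Fin.mk_one, Fin.reduceFinMk, of_apply,
        cons_val, cons_val_zero, cons_val_one]
    · exact hasDerivAt_const _ _
    · exact hu₃.congr_of_eventuallyEq (.of_forall fun x => by simp [mul_comm])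
    · exact hv₃.congr_of_eventuallyEq (.of_forall fun x => by simp [mul_comm])
    · exact hu₃.conj_comp.congr_of_eventuallyEq
        (.of_forall fun x => by simp [mul_comm, conj_rho])
    · exact hasDerivAt_const _ _
    · exact hasDerivAt_const _ _
    · exact hv₃.conj_comp.congr_of_eventuallyEq
        (.of_forall fun x => by simp [mul_comm, conj_rho])
    · exact hasDerivAt_const _ _
    · exact hasDerivAt_const _ _
  ext i j
  refine (((((hU₁ i j).const_mul (2 * lam ^ 3)).const_sub ((2 * I * lam ^ 4) * Lam i j)).add
    ((hU₂ i j).const_mul (I * lam ^ 2))).sub ((hU₃ i j).const_mul lam)).deriv.trans ?_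
  simp only [Matrix.sub_apply, Matrix.add_apply, Matrix.smul_apply, smul_eq_mul,
    neg_smul, Matrix.neg_apply]

theorem zero_curvature_eq_smul {u v : ℝ × ℝ → ℂ} (hu : ContDiff ℝ 2 u) (hv : ContDiff ℝ 2 v)
    (lam : ℂ) (p : ℝ × ℝ) :
    pdtM (Umat u v lam) p - pdxM (Vmat u v lam) p
        + Umat u v lam p * Vmat u v lam p - Vmat u v lam p * Umat u v lam p =
      lam • !![0, pdt u p + pdx (fun q => rho u v q * u q) p - I * pdx (pdx u) p,
                  pdt v p + pdx (fun q => rho u v q * v q) p - I * pdx (pdx v) p;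
        conj (pdt u p + pdx (fun q => rho u v q * u q) p - I * pdx (pdx u) p), 0, 0;
        conj (pdt v p + pdx (fun q => rho u v q * v q) p - I * pdx (pdx v) p), 0, 0] := by
  rw [pdtM_Umat hu hv, pdxM_Vmat hu hv]
  ext i j
  have hI := I_mul_I
  generalize pdx (fun q => rho u v q * u q) p = ru
  generalize pdx (fun q => rho u v q * v q) p = rv
  fin_cases i <;> fin_cases j <;>
    simp [Umat, Vmat, Lam, U1mat, U2mat, U3mat, pdx_conj, rho, -neg_add_rev] <;> grind

/-- The zero-curvature equation `∂U/∂t − ∂V/∂x + UV − VU = 0` holds for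
every spectral parameter `λ` if and only if `(u,v)` solves the CDNLS system
`i u_t + u_xx + i(ρu)_x = 0`, `i v_t + v_xx + i(ρv)_x = 0`. -/
theorem zero_curvature_iff_CDNLS (u v : ℝ × ℝ → ℂ)
    (hu : ContDiff ℝ 2 u) (hv : ContDiff ℝ 2 v) :
    (∀ (lam : ℂ) (p : ℝ × ℝ),
        pdtM (fun q => Umat u v lam q) p - pdxM (fun q => Vmat u v lam q) p
          + Umat u v lam p * Vmat u v lam p - Vmat u v lam p * Umat u v lam p = 0)
      ↔ (∀ p : ℝ × ℝ,
          I * pdt u p + pdx (pdx u) p + I * pdx (fun q => rho u v q * u q) p = 0 ∧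
          I * pdt v p + pdx (pdx v) p + I * pdx (fun q => rho u v q * v q) p = 0) := by
  have hE : ∀ a b c : ℂ, a + c - I * b = 0 ↔ I * a + b + I * c = 0 := fun a b c => by
    rw [← mul_eq_zero_iff_left I_ne_zero]
    ring_nf
    simp [add_right_comm]
  simp only [zero_curvature_eq_smul hu hv, ← hE]
  constructor
  · intro h p
    exact ⟨by simpa using congrFun (congrFun (h 1 p) 0) 1,
      by simpa using congrFun (congrFun (h 1 p) 0) 2⟩
  · intro h lam p
    obtain ⟨h₁, h₂⟩ := h p
    ext i j
    fin_cases i <;> fin_cases j <;> simp [h₁, h₂, -map_sub, -map_add]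
end
end

section
/- (Symmetry of the eigenfunctions, Lemma 2.2.) Let A = diag(1,−1,−1) and let u,v : ℝ² → ℂ be continuously differentiable. Suppose that for every λ ∈ ℂ the map ψ(·,·,λ) : ℝ² → GL₃(ℂ) is continuously differentiable and satisfies ψ_x = U(x,t,λ)ψ and ψ_t = V(x,t,λ)ψ on ℝ², and that at some base point (x₀,t₀) one has ψ(x₀,t₀,λ)^{−1} = A·conj(ψ(x₀,t₀, conj(λ)))ᵀ·A for every λ ∈ ℂ. Then ψ(x,t,λ)^{−1} = A·conj(ψ(x,t, conj(λ)))ᵀ·A for all (x,t) ∈ ℝ² and all λ ∈ ℂ. -/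
open Matrix Complex ComplexConjugate

noncomputable section

/-- Product rule for matrix-valued functions, entrywise. -/
theorem hasDerivAt_matrix_mul_apply {F G : ℝ → M3} {F' G' : M3} {s : ℝ}
    (hF : ∀ i j, HasDerivAt (fun x => F x i j) (F' i j) s)
    (hG : ∀ i j, HasDerivAt (fun x => G x i j) (G' i j) s) (i j : Fin 3) :
    HasDerivAt (fun x => (F x * G x) i j) ((F' * G s + F s * G') i j) s := by
  simp only [Matrix.add_apply, Matrix.mul_apply, ← Finset.sum_add_distrib]
  exact HasDerivAt.fun_sum fun k _ => (hF i k).mul (hG k j)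

/-- If `F' = M F` and `G' = N G` with `Nᴴ A + A M = 0`, then `Gᴴ A F` is constant. -/
theorem conjTranspose_mul_mul_eq_of_deriv {F G M N : ℝ → M3} {A : M3}
    (hF : ∀ s i j, HasDerivAt (fun x => F x i j) ((M s * F s) i j) s)
    (hG : ∀ s i j, HasDerivAt (fun x => G x i j) ((N s * G s) i j) s)
    (hMN : ∀ s, (N s)ᴴ * A + A * M s = 0) (a b : ℝ) :
    (G a)ᴴ * A * F a = (G b)ᴴ * A * F b := by
  have hGA : ∀ s i j, HasDerivAt (fun x => ((G x)ᴴ * A) i j) (((N s * G s)ᴴ * A) i j) s := by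
    intro s i j
    have h := hasDerivAt_matrix_mul_apply (F := fun x => (G x)ᴴ) (F' := (N s * G s)ᴴ)
      (G := fun _ => A) (G' := 0) (s := s) (fun k l => (hG s l k).star)
      (fun k l => hasDerivAt_const s (A k l)) i j
    simpa using h
  have hzero : ∀ s i j, HasDerivAt (fun x => ((G x)ᴴ * A * F x) i j) 0 s := by
    intro s i j
    have h := hasDerivAt_matrix_mul_apply (hGA s) (hF s) i j
    have hcancel : (N s * G s)ᴴ * A * F s + (G s)ᴴ * A * (M s * F s) = 0 := by
      have : (N s * G s)ᴴ * A * F s + (G s)ᴴ * A * (M s * F s)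
          = (G s)ᴴ * ((N s)ᴴ * A + A * M s) * F s := by
        rw [conjTranspose_mul]; noncomm_ring
      rw [this, hMN, mul_zero, zero_mul]
    rwa [hcancel] at h
  ext i j
  exact is_const_of_deriv_eq_zero (fun s => (hzero s i j).differentiableAt)
    (fun s => (hzero s i j).deriv) a b

theorem Umat_symmetry (u v : ℝ × ℝ → ℂ) (lam : ℂ) (p : ℝ × ℝ) :
    (Umat u v (conj lam) p)ᴴ * Amat + Amat * Umat u v lam p = 0 := by
  ext i j
  fin_cases i <;> fin_cases j <;>
    simp [Umat, Lam, U1mat, Amat, Matrix.mul_apply, Fin.sum_univ_three]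

theorem Vmat_symmetry (u v : ℝ × ℝ → ℂ) (lam : ℂ) (p : ℝ × ℝ) :
    (Vmat u v (conj lam) p)ᴴ * Amat + Amat * Vmat u v lam p = 0 := by
  have conj_two : conj (2 : ℂ) = 2 := conj_ofNat 2
  ext i j
  fin_cases i <;> fin_cases j <;>
    simp [Vmat, Lam, U1mat, U2mat, U3mat, rho, pdx_conj, conj_two, Amat, Matrix.mul_apply,
      Fin.sum_univ_three] <;> ring

theorem Amat_mul_Amat : Amat * Amat = 1 := by
  ext i j
  fin_cases i <;> fin_cases j <;> simp [Amat, Matrix.mul_apply, Fin.sum_univ_three]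

/-- The symmetry relation says that `Yᴴ A X = A`. -/
theorem inv_eq_iff_conjTranspose_mul {X Y : M3} (hX : IsUnit X) :
    X⁻¹ = Amat * (Y.map (starRingEnd ℂ))ᵀ * Amat ↔ Yᴴ * Amat * X = Amat := by
  have hdet := (Matrix.isUnit_iff_isUnit_det X).1 hX
  change X⁻¹ = Amat * Yᴴ * Amat ↔ _
  constructor
  · intro h
    calc Yᴴ * Amat * X = (Amat * Amat) * (Yᴴ * Amat * X) := by rw [Amat_mul_Amat, one_mul]
      _ = Amat * ((Amat * Yᴴ * Amat) * X) := by simp only [mul_assoc]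
      _ = Amat := by rw [← h, Matrix.nonsing_inv_mul X hdet, mul_one]
  · intro h
    refine Matrix.inv_eq_left_inv ?_
    rw [mul_assoc, mul_assoc, ← mul_assoc Yᴴ, h, Amat_mul_Amat]

/-- **Lemma 2.2.** If `ψ(·,·,λ)` takes invertible values, is `C¹`, solves
`ψ_x = Uψ`, `ψ_t = Vψ`, and at some base point `p₀` satisfies the symmetry
`ψ(p₀,λ)⁻¹ = A·conj(ψ(p₀,conj λ))ᵀ·A` for every `λ`, then
`ψ(x,t,λ)⁻¹ = A·conj(ψ(x,t,conj λ))ᵀ·A` everywhere. -/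
theorem psi_symmetry (u v : ℝ × ℝ → ℂ) (hu : ContDiff ℝ 1 u) (hv : ContDiff ℝ 1 v)
    (ψ : ℂ → ℝ × ℝ → M3)
    (hψsmooth : ∀ (lam : ℂ) (i j : Fin 3), ContDiff ℝ 1 (fun p => ψ lam p i j))
    (hψinv : ∀ (lam : ℂ) (p : ℝ × ℝ), IsUnit (ψ lam p))
    (hψx : ∀ (lam : ℂ) (p : ℝ × ℝ), pdxM (ψ lam) p = Umat u v lam p * ψ lam p)
    (hψt : ∀ (lam : ℂ) (p : ℝ × ℝ), pdtM (ψ lam) p = Vmat u v lam p * ψ lam p)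
    (p₀ : ℝ × ℝ)
    (hbase : ∀ lam : ℂ,
      (ψ lam p₀)⁻¹ = Amat * ((ψ (conj lam) p₀).map (starRingEnd ℂ))ᵀ * Amat) :
    ∀ (p : ℝ × ℝ) (lam : ℂ),
      (ψ lam p)⁻¹ = Amat * ((ψ (conj lam) p).map (starRingEnd ℂ))ᵀ * Amat := by
  intro p lam
  have hdiff : ∀ (mu : ℂ) i j, Differentiable ℝ (fun q => ψ mu q i j) := fun mu i j =>
    (hψsmooth mu i j).differentiable one_ne_zero
  have hx : ∀ (mu : ℂ) (t s : ℝ) i j,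
      HasDerivAt (fun x => ψ mu (x, t) i j) ((Umat u v mu (s, t) * ψ mu (s, t)) i j) s := by
    intro mu t s i j
    rw [← hψx]
    exact ((hdiff mu i j).comp
      (differentiable_id.prodMk (differentiable_const t)) s).hasDerivAt
  have ht : ∀ (mu : ℂ) (x s : ℝ) i j,
      HasDerivAt (fun t => ψ mu (x, t) i j) ((Vmat u v mu (x, s) * ψ mu (x, s)) i j) s := by
    intro mu x s i j
    rw [← hψt]
    exact ((hdiff mu i j).comp
      ((differentiable_const x).prodMk differentiable_id) s).hasDerivAt
  rw [inv_eq_iff_conjTranspose_mul (hψinv lam p)]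
  calc (ψ (conj lam) p)ᴴ * Amat * ψ lam p
      = (ψ (conj lam) (p₀.1, p.2))ᴴ * Amat * ψ lam (p₀.1, p.2) :=
        conjTranspose_mul_mul_eq_of_deriv (hx lam p.2) (hx (conj lam) p.2)
          (fun s => Umat_symmetry u v lam (s, p.2)) p.1 p₀.1
    _ = (ψ (conj lam) p₀)ᴴ * Amat * ψ lam p₀ :=
        conjTranspose_mul_mul_eq_of_deriv (ht lam p₀.1) (ht (conj lam) p₀.1)
          (fun s => Vmat_symmetry u v lam (p₀.1, s)) p.2 p₀.2
    _ = Amat := (inv_eq_iff_conjTranspose_mul (hψinv lam p₀)).1 (hbase lam)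
end
end
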